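/- Let M = (E,r) be a polymatroid and a ∈ E. Let k̲ and k̄ be the minimum and maximum of the coordinate x_a over x ∈ P(M), and for each integer k with k̲ ≤ k ≤ k̄ let N_k = {x ∈ P(M) : x_a = k} be the corresponding a-slice, with counting function Q_{N_k}(t,u) = #((N_k + uΔ' + t∇') ∩ ℤ^E) and associated polynomial Q'_{N_k} obtained from a Q'-datum for Q_{N_k}. Let Q'_M be the polynomial associated to a Q'-datum for M. Then Q'_M(x,y) = (x−1)·Q'_{N_{k̲}}(x,y) + (y−1)·Q'_{N_{k̄}}(x,y) + Σ_{k=k̲}^{k̄} Q'_{N_k}(x,y). (Here N_{k̲} is the base polytope of the deletion M∖a and N_{k̄} that of the contraction M/a, embedded in ℝ^E.) -/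

import Mathlib

open scoped Pointwise
open Finset

noncomputable section

/-- The standard simplex `Δ = conv{e_i : i ∈ E}` in `ℝ^E`. -/
def stdSimplexSet (α : Type*) [Fintype α] [DecidableEq α] : Set (α → ℝ) :=
  convexHull ℝ {x : α → ℝ | ∃ i : α, x = Pi.single i (1 : ℝ)}

/-- The number of lattice points (points of `ℤ^E`) in a subset of `ℝ^E`. -/
def latticeCount {α : Type*} (P : Set (α → ℝ)) : ℕ :=
  Set.ncard {q : α → ℤ | (fun i => (q i : ℝ)) ∈ P}

/-- `Qcount P t u` is the number of lattice points of `P + uΔ + t∇`. -/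
def Qcount {α : Type*} [Fintype α] [DecidableEq α] (P : Set (α → ℝ)) (t u : ℕ) : ℕ :=
  latticeCount (P + (u : ℝ) • stdSimplexSet α + (t : ℝ) • (-stdSimplexSet α))

/-- A polymatroid on a finite ground set, given by its rank function. -/
structure PolyMatroid (α : Type*) [Fintype α] [DecidableEq α] where
  rk : Finset α → ℕ
  rk_empty : rk ∅ = 0
  rk_mono : ∀ ⦃S T : Finset α⦄, S ⊆ T → rk S ≤ rk T
  rk_submod : ∀ S T : Finset α, rk (S ∪ T) + rk (S ∩ T) ≤ rk S + rk T

variable {α : Type*} [Fintype α] [DecidableEq α]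

/-- A basis of a matroid (an independent spanning set). -/
def PolyMatroid.IsBasis (M : PolyMatroid α) (B : Finset α) : Prop :=
  M.rk B = B.card ∧ M.rk B = M.rk Finset.univ

/-- The indicator vector of a finite set. -/
def indicatorVec {α : Type*} [DecidableEq α] (B : Finset α) : α → ℝ :=
  fun i => if i ∈ B then 1 else 0

/-- The base polytope of a matroid: the convex hull of indicator vectors of bases. -/
def matroidPolytope (M : PolyMatroid α) : Set (α → ℝ) :=
  convexHull ℝ {x : α → ℝ | ∃ B : Finset α, M.IsBasis B ∧ x = indicatorVec B}

/-- The base polytope of a polymatroid, by its inequality description. -/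
def PolyMatroid.polytope (M : PolyMatroid α) : Set (α → ℝ) :=
  {x | (∑ i, x i) = (M.rk Finset.univ : ℝ) ∧
    ∀ S : Finset α, (∑ i ∈ S, x i) ≤ (M.rk S : ℝ)}

/-- `c : ℕ × ℕ → ℤ` is a `Q'`-datum for the counting function `Q` if it is finitely
supported and interpolates `Q` in the binomial basis. -/
def IsQdatumFun (Q : ℕ → ℕ → ℕ) (c : ℕ × ℕ → ℤ) : Prop :=
  (Function.support c).Finite ∧
    ∀ t u : ℕ, (Q t u : ℤ) = ∑ᶠ p : ℕ × ℕ, c p * (t.choose p.1 : ℤ) * (u.choose p.2 : ℤ)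

/-- A `Q'`-datum for the lattice-point counting function of the polytope `P`. -/
def IsQdatum (P : Set (α → ℝ)) (c : ℕ × ℕ → ℤ) : Prop :=
  IsQdatumFun (Qcount P) c

/-- The polynomial `Q'` associated to a `Q'`-datum, as a function on `ℚ × ℚ`. -/
def Qprime (c : ℕ × ℕ → ℤ) (x y : ℚ) : ℚ :=
  ∑ᶠ p : ℕ × ℕ, (c p : ℚ) * (x - 1) ^ p.1 * (y - 1) ^ p.2

/-- The polynomial `Q'` associated to a `Q'`-datum, as a polynomial in two variables. -/
def QprimePoly (c : ℕ × ℕ → ℤ) : MvPolynomial (Fin 2) ℤ :=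
  ∑ᶠ p : ℕ × ℕ,
    MvPolynomial.C (c p) * (MvPolynomial.X 0 - 1) ^ p.1 * (MvPolynomial.X 1 - 1) ^ p.2

/-- The Tutte polynomial of a matroid, as a function on `ℚ × ℚ`. -/
def TuttePoly (M : PolyMatroid α) (x y : ℚ) : ℚ :=
  ∑ S : Finset α,
    (x - 1) ^ (M.rk Finset.univ - M.rk S) * (y - 1) ^ (S.card - M.rk S)


variable {α : Type*} [Fintype α] [DecidableEq α]

/-- The simplex `Δ' = conv{e_i : i ∈ E, i ≠ a}` in `ℝ^E`. -/
def stdSimplexAway (α : Type*) [Fintype α] [DecidableEq α] (a : α) : Set (α → ℝ) :=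
  convexHull ℝ {x : α → ℝ | ∃ i : α, i ≠ a ∧ x = Pi.single i (1 : ℝ)}

/-- The `a`-slice `N_k = {x ∈ P(M) : x_a = k}` of the base polytope. -/
def PolyMatroid.slice (M : PolyMatroid α) (a : α) (k : ℤ) : Set (α → ℝ) :=
  {x ∈ M.polytope | x a = (k : ℝ)}

/-- The counting function `Q_{N}(t,u) = #((N + uΔ' + t∇') ∩ ℤ^E)` for a slice. -/
def QcountSlice (a : α) (P : Set (α → ℝ)) (t u : ℕ) : ℕ :=
  latticeCount (P + (u : ℝ) • stdSimplexAway α a + (t : ℝ) • (-stdSimplexAway α a))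

section BinomialBasis

/-- The values at `(t, u)` of the combination of binomial products with coefficients `c`. -/
def binomialEval (t u : ℕ) : (ℕ × ℕ →₀ ℤ) →ₗ[ℤ] ℤ :=
  Finsupp.lsum ℤ fun p => LinearMap.mulRight ℤ ((t.choose p.1 : ℤ) * (u.choose p.2 : ℤ))

/-- The polynomial with coefficients `c` in the basis `(x-1)^i (y-1)^j`. -/
def shiftedPoly : (ℕ × ℕ →₀ ℤ) →ₗ[ℤ] MvPolynomial (Fin 2) ℤ :=
  Finsupp.lsum ℤ fun p => LinearMap.toSpanSingleton ℤ (MvPolynomial (Fin 2) ℤ)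
    ((MvPolynomial.X 0 - 1) ^ p.1 * (MvPolynomial.X 1 - 1) ^ p.2)

lemma binomialEval_apply (t u : ℕ) (c : ℕ × ℕ →₀ ℤ) :
    binomialEval t u c = c.sum fun p z => z * ((t.choose p.1 : ℤ) * (u.choose p.2 : ℤ)) := by
  rfl

lemma shiftedPoly_apply (c : ℕ × ℕ →₀ ℤ) :
    shiftedPoly c = c.sum fun p z =>
      z • ((MvPolynomial.X 0 - 1) ^ p.1 * (MvPolynomial.X 1 - 1) ^ p.2) := by
  rfl

/-- A function on pairs of naturals is determined by its binomial transform. -/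
lemma eq_zero_of_binomialEval_eq_zero {c : ℕ × ℕ →₀ ℤ} (h : ∀ t u, binomialEval t u c = 0) :
    c = 0 := by
  ext p
  induction p using WellFoundedLT.induction with
  | ind p ih =>
    have hp := h p.1 p.2
    rw [binomialEval_apply, Finsupp.sum, Finset.sum_eq_single p] at hp
    · simpa using hp
    · intro q _ hq
      by_cases hle : q ≤ p
      · simp [ih q (lt_of_le_of_ne hle hq)]
      · rw [Prod.le_def, not_and_or, not_le, not_le] at hle
        rcases hle with hle | hle <;> simp [Nat.choose_eq_zero_of_lt hle]
    · intro hq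
      simp [Finsupp.notMem_support_iff.mp hq]

lemma eq_of_binomialEval_eq {c d : ℕ × ℕ →₀ ℤ}
    (h : ∀ t u, binomialEval t u c = binomialEval t u d) : c = d :=
  sub_eq_zero.mp <| eq_zero_of_binomialEval_eq_zero fun t u => by rw [map_sub, h, sub_self]

lemma sum_range_choose_eq (t i : ℕ) :
    ∑ s ∈ Finset.range t, (s.choose i : ℤ) = (t.choose (i + 1) : ℤ) := by
  induction t with
  | zero => simp
  | succ t ih => rw [Finset.sum_range_succ, ih, Nat.choose_succ_succ]; push_cast; ring

lemma binomialEval_mapDomain_fst (t u : ℕ) (c : ℕ × ℕ →₀ ℤ) :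
    binomialEval t u (c.mapDomain fun p => (p.1 + 1, p.2)) =
      ∑ s ∈ Finset.range t, binomialEval s u c := by
  induction c using Finsupp.induction_linear with
  | zero => simp
  | add f g hf hg => simp [Finsupp.mapDomain_add, hf, hg, Finset.sum_add_distrib]
  | single p z =>
    simp [Finsupp.mapDomain_single, binomialEval, ← sum_range_choose_eq, Finset.mul_sum]

lemma binomialEval_mapDomain_snd (t u : ℕ) (c : ℕ × ℕ →₀ ℤ) :
    binomialEval t u (c.mapDomain fun p => (p.1, p.2 + 1)) =
      ∑ s ∈ Finset.range u, binomialEval t s c := by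
  induction c using Finsupp.induction_linear with
  | zero => simp
  | add f g hf hg => simp [Finsupp.mapDomain_add, hf, hg, Finset.sum_add_distrib]
  | single p z =>
    simp [Finsupp.mapDomain_single, binomialEval, ← sum_range_choose_eq, Finset.mul_sum]

lemma shiftedPoly_mapDomain_fst (c : ℕ × ℕ →₀ ℤ) :
    shiftedPoly (c.mapDomain fun p => (p.1 + 1, p.2)) =
      (MvPolynomial.X 0 - 1) * shiftedPoly c := by
  induction c using Finsupp.induction_linear with
  | zero => simp
  | add f g hf hg => simp [Finsupp.mapDomain_add, hf, hg, mul_add]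
  | single p z => simp [Finsupp.mapDomain_single, shiftedPoly, pow_succ]; ring

lemma shiftedPoly_mapDomain_snd (c : ℕ × ℕ →₀ ℤ) :
    shiftedPoly (c.mapDomain fun p => (p.1, p.2 + 1)) =
      (MvPolynomial.X 1 - 1) * shiftedPoly c := by
  induction c using Finsupp.induction_linear with
  | zero => simp
  | add f g hf hg => simp [Finsupp.mapDomain_add, hf, hg, mul_add]
  | single p z => simp [Finsupp.mapDomain_single, shiftedPoly, pow_succ]; ring

lemma QprimePoly_coe (c : ℕ × ℕ →₀ ℤ) : QprimePoly c = shiftedPoly c := by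
  rw [QprimePoly, shiftedPoly_apply, Finsupp.sum,
    finsum_eq_sum_of_support_subset (s := c.support)]
  · refine Finset.sum_congr rfl fun p _ => ?_
    rw [zsmul_eq_mul, mul_assoc]
    simp
  · intro p hp
    simp only [Function.mem_support] at hp
    simp only [Finset.mem_coe, Finsupp.mem_support_iff]
    rintro h
    simp [h] at hp

lemma IsQdatumFun.binomialEval_eq {Q : ℕ → ℕ → ℕ} {c : ℕ × ℕ →₀ ℤ} (h : IsQdatumFun Q c)
    (t u : ℕ) : binomialEval t u c = Q t u := by
  rw [h.2 t u, binomialEval_apply, Finsupp.sum,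
    finsum_eq_sum_of_support_subset (s := c.support)]
  · exact Finset.sum_congr rfl fun p _ => (mul_assoc _ _ _).symm
  · intro p hp
    simp only [Function.mem_support] at hp
    simp only [Finset.mem_coe, Finsupp.mem_support_iff]
    rintro h
    simp [h] at hp

lemma IsQdatumFun.exists_finsupp {Q : ℕ → ℕ → ℕ} {c : ℕ × ℕ → ℤ} (h : IsQdatumFun Q c) :
    ∃ d : ℕ × ℕ →₀ ℤ, c = d :=
  ⟨Finsupp.ofSupportFinite c h.1, rfl⟩

end BinomialBasis

section SimplexSums

/-- The face of the standard simplex spanned by the coordinates satisfying `p`. -/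
lemma mem_convexHull_single_iff (p : α → Prop) (w : α → ℝ) :
    w ∈ convexHull ℝ {x : α → ℝ | ∃ i : α, p i ∧ x = Pi.single i (1 : ℝ)} ↔
      (∀ i, 0 ≤ w i) ∧ ∑ i, w i = 1 ∧ ∀ i, ¬ p i → w i = 0 := by
  constructor
  · intro hw
    refine convexHull_min
      (t := {w : α → ℝ | (∀ i, 0 ≤ w i) ∧ ∑ i, w i = 1 ∧ ∀ i, ¬ p i → w i = 0}) ?_ ?_ hw
    · rintro x ⟨i, hi, rfl⟩
      refine ⟨fun j => ?_, by simp, fun j hj => ?_⟩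
      · by_cases h : j = i
        · subst h; simp
        · simp [h]
      · have : j ≠ i := by rintro rfl; exact hj hi
        simp [this]
    · rintro x ⟨hx0, hx1, hxp⟩ y ⟨hy0, hy1, hyp⟩ s t hs ht hst
      refine ⟨fun i => ?_, ?_, fun i hi => ?_⟩
      · have := mul_nonneg hs (hx0 i)
        have := mul_nonneg ht (hy0 i)
        simp only [Pi.add_apply, Pi.smul_apply, smul_eq_mul]
        linarith
      · simp [Finset.sum_add_distrib, ← Finset.mul_sum, hx1, hy1, hst]
      · simp [hxp i hi, hyp i hi]
  · rintro ⟨h0, h1, hp⟩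
    classical
    have hw : w = ∑ i ∈ Finset.univ.filter p, w i • (Pi.single i (1 : ℝ) : α → ℝ) := by
      ext j
      simp only [Finset.sum_apply, Pi.smul_apply, Pi.single_apply, smul_eq_mul, mul_ite, mul_one,
        mul_zero, Finset.sum_ite_eq, Finset.mem_filter, Finset.mem_univ, true_and]
      split_ifs with h
      · rfl
      · exact hp j h
    rw [hw]
    refine (convex_convexHull ℝ _).sum_mem (fun i _ => h0 i) ?_ fun i hi =>
      subset_convexHull ℝ _ ⟨i, (Finset.mem_filter.mp hi).2, rfl⟩
    rw [← h1]
    exact Finset.sum_subset (Finset.filter_subset _ _) fun i _ hi => hp i (by simpa using hi)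

lemma mem_smul_convexHull_single_iff {p : α → Prop} (hne : ∃ i, p i) {u : ℝ} (hu : 0 ≤ u)
    (w : α → ℝ) :
    w ∈ u • convexHull ℝ {x : α → ℝ | ∃ i : α, p i ∧ x = Pi.single i (1 : ℝ)} ↔
      (∀ i, 0 ≤ w i) ∧ ∑ i, w i = u ∧ ∀ i, ¬ p i → w i = 0 := by
  rw [Set.mem_smul_set]
  constructor
  · rintro ⟨v, hv, rfl⟩
    obtain ⟨h0, h1, h2⟩ := (mem_convexHull_single_iff p v).mp hv
    refine ⟨fun i => mul_nonneg hu (h0 i), ?_, fun i hi => by simp [h2 i hi]⟩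
    simp [← Finset.mul_sum, h1]
  · rintro ⟨h0, h1, h2⟩
    rcases hu.eq_or_lt with rfl | hu
    · obtain ⟨i, hi⟩ := hne
      refine ⟨Pi.single i 1, subset_convexHull ℝ _ ⟨i, hi, rfl⟩, ?_⟩
      have := (Finset.sum_eq_zero_iff_of_nonneg fun i _ => h0 i).mp h1
      ext j
      simp [this j (Finset.mem_univ j)]
    · refine ⟨u⁻¹ • w, (mem_convexHull_single_iff p _).mpr
        ⟨fun i => mul_nonneg (inv_nonneg.mpr hu.le) (h0 i), ?_, fun i hi => by simp [h2 i hi]⟩, ?_⟩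
      · simp [← Finset.mul_sum, h1, hu.ne']
      · rw [smul_smul, mul_inv_cancel₀ hu.ne', one_smul]

/-- Membership in `X + uΔ_p + t∇_p` is a bound on the total positive part of a difference. -/
lemma mem_add_smul_simplex_iff {p : α → Prop} (hne : ∃ i, p i) (X : Set (α → ℝ)) (t u : ℕ)
    (q : α → ℝ) :
    q ∈ X + (u : ℝ) • convexHull ℝ {x : α → ℝ | ∃ i : α, p i ∧ x = Pi.single i (1 : ℝ)} +
        (t : ℝ) • (-convexHull ℝ {x : α → ℝ | ∃ i : α, p i ∧ x = Pi.single i (1 : ℝ)}) ↔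
      ∃ x ∈ X, (∀ i, ¬ p i → q i = x i) ∧ ∑ i, q i = ∑ i, x i + u - t ∧
        ∑ i, max (q i - x i) 0 ≤ u := by
  simp only [Set.mem_add, Set.smul_set_neg, Set.mem_neg,
    mem_smul_convexHull_single_iff hne (Nat.cast_nonneg _)]
  constructor
  · rintro ⟨_, ⟨x, hx, v, ⟨hv0, hv1, hv2⟩, rfl⟩, w, ⟨hw0, hw1, hw2⟩, rfl⟩
    refine ⟨x, hx, fun i hi => ?_, ?_, ?_⟩
    · have := hw2 i hi
      simp only [Pi.neg_apply, neg_eq_zero] at this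
      simp [hv2 i hi, this]
    · simp only [Pi.neg_apply, Finset.sum_neg_distrib] at hw1
      simp only [Pi.add_apply, Finset.sum_add_distrib, hv1]
      linarith
    · rw [← hv1]
      refine Finset.sum_le_sum fun i _ => ?_
      have := hw0 i
      simp only [Pi.neg_apply] at this
      simp only [Pi.add_apply]
      exact max_le (by linarith) (hv0 i)
  · rintro ⟨x, hx, hoff, hsum, hpos⟩
    obtain ⟨b, hb⟩ := hne
    set s : ℝ := u - ∑ i, max (q i - x i) 0 with hs
    have hs0 : 0 ≤ s := by linarith
    have hsingle : ∀ i, 0 ≤ (Pi.single b s : α → ℝ) i := fun i =>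
      (Pi.single_nonneg.mpr hs0 : (0 : α → ℝ) ≤ Pi.single b s) i
    have hbne : ∀ i, ¬ p i → i ≠ b := by
      rintro i hi rfl
      exact hi hb
    have hdiff : ∀ i, max (q i - x i) 0 - max (x i - q i) 0 = q i - x i := fun i => by
      rcases le_total (q i) (x i) with h | h
      · rw [max_eq_right (by linarith), max_eq_left (by linarith)]; ring
      · rw [max_eq_left (by linarith), max_eq_right (by linarith)]; ring
    refine ⟨x + fun i => max (q i - x i) 0 + (Pi.single b s : α → ℝ) i,
      ⟨x, hx, _, ⟨fun i => add_nonneg (le_max_right _ _) (hsingle i), ?_, fun i hi => ?_⟩, rfl⟩,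
      fun i => -(max (x i - q i) 0 + (Pi.single b s : α → ℝ) i),
      ⟨fun i => ?_, ?_, fun i hi => ?_⟩, ?_⟩
    · rw [Finset.sum_add_distrib, Finset.sum_pi_single']
      simp [hs]
    · simp [hoff i hi, hbne i hi]
    · simpa using add_nonneg (le_max_right (x i - q i) 0) (hsingle i)
    · simp only [Pi.neg_apply, neg_neg, Finset.sum_add_distrib, Finset.sum_pi_single',
        Finset.mem_univ, if_true]
      have := Finset.sum_congr rfl fun i (_ : i ∈ Finset.univ) => hdiff i
      simp only [Finset.sum_sub_distrib] at this
      linarith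
    · simp [hoff i hi, hbne i hi]
    · ext i
      have := hdiff i
      simp only [Pi.add_apply]
      linarith

end SimplexSums

namespace PolyMatroid

variable {M : PolyMatroid α} {x : α → ℝ} {a b : α}

lemma coord_nonneg (hx : x ∈ M.polytope) (i : α) : 0 ≤ x i := by
  have h := hx.2 (Finset.univ.erase i)
  have hm : (M.rk (Finset.univ.erase i) : ℝ) ≤ M.rk Finset.univ := by
    exact_mod_cast M.rk_mono (Finset.erase_subset i Finset.univ)
  have := Finset.add_sum_erase Finset.univ x (Finset.mem_univ i)
  linarith [hx.1]

lemma coord_le (hx : x ∈ M.polytope) (i : α) : x i ≤ M.rk {i} := by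
  simpa using hx.2 {i}

lemma isCompact_polytope (M : PolyMatroid α) : IsCompact M.polytope := by
  refine (isCompact_Icc (a := (0 : α → ℝ)) (b := fun i => (M.rk {i} : ℝ))).of_isClosed_subset ?_
    fun x hx => ⟨fun i => coord_nonneg hx i, fun i => coord_le hx i⟩
  have : M.polytope = {x : α → ℝ | ∑ i, x i = (M.rk Finset.univ : ℝ)} ∩
      ⋂ S : Finset α, {x : α → ℝ | ∑ i ∈ S, x i ≤ (M.rk S : ℝ)} := by
    ext x; simp [polytope]
  rw [this]
  exact (isClosed_eq (by fun_prop) continuous_const).inter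
    (isClosed_iInter fun S => isClosed_le (by fun_prop) continuous_const)

/-- A set is tight at `x` when its rank inequality is an equality. -/
def Tight (M : PolyMatroid α) (x : α → ℝ) (S : Finset α) : Prop :=
  ∑ i ∈ S, x i = (M.rk S : ℝ)

lemma tight_union_inter (hx : x ∈ M.polytope) {S T : Finset α} (hS : M.Tight x S)
    (hT : M.Tight x T) : M.Tight x (S ∪ T) ∧ M.Tight x (S ∩ T) := by
  have h1 := hx.2 (S ∪ T)
  have h2 := hx.2 (S ∩ T)
  have h3 : (M.rk (S ∪ T) : ℝ) + M.rk (S ∩ T) ≤ M.rk S + M.rk T := by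
    exact_mod_cast M.rk_submod S T
  have h4 := Finset.sum_union_inter (s₁ := S) (s₂ := T) (f := x)
  unfold Tight at *
  constructor <;> linarith

/-- Mass can be moved from `b` to `a` unless a tight set separates `a` from `b`. -/
lemma exists_transfer (hx : x ∈ M.polytope)
    (h : ∀ S, M.Tight x S → a ∈ S → b ∈ S) {δ : ℝ} (hδ : 0 < δ) :
    ∃ ε, 0 < ε ∧ ε ≤ δ ∧ x + Pi.single a ε - Pi.single b ε ∈ M.polytope := by
  classical
  let slack : Finset α → ℝ := fun S =>
    if M.Tight x S then δ else (M.rk S : ℝ) - ∑ i ∈ S, x i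
  have hslack : ∀ S, 0 < slack S := fun S => by
    simp only [slack]
    split_ifs with hS
    · exact hδ
    · exact sub_pos.mpr (lt_of_le_of_ne (hx.2 S) hS)
  obtain ⟨S₀, -, hS₀⟩ := Finset.exists_min_image Finset.univ slack Finset.univ_nonempty
  refine ⟨min δ (slack S₀), lt_min hδ (hslack _), min_le_left _ _, ?_, fun S => ?_⟩
  · simp [Finset.sum_add_distrib, hx.1]
  · simp only [Pi.add_apply, Pi.sub_apply, Finset.sum_add_distrib, Finset.sum_sub_distrib,
      Finset.sum_pi_single']
    have h0 : 0 < min δ (slack S₀) := lt_min hδ (hslack _)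
    have hle := hx.2 S
    have hmin := hS₀ S (Finset.mem_univ _)
    have hmin' := min_le_right δ (slack S₀)
    by_cases ha : a ∈ S <;> by_cases hb : b ∈ S <;> simp only [ha, hb, if_true, if_false]
    · linarith
    · have hnt : ¬ M.Tight x S := fun ht => hb (h S ht ha)
      simp only [slack, if_neg hnt] at hmin hmin'
      linarith
    · linarith
    · linarith

/-- A point of the polytope can be moved up in direction `a`, lowering the other coordinates. -/
lemma exists_raise (hx : x ∈ M.polytope) {K : ℝ} (hxK : x a ≤ K) (hK : K ≤ M.rk {a}) :
    ∃ y ∈ M.polytope, y a = K ∧ ∀ i, i ≠ a → y i ≤ x i := by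
  let F : Set (α → ℝ) := M.polytope ∩ {y | y a ≤ K ∧ ∀ i, i ≠ a → y i ≤ x i}
  have hF : IsCompact F := by
    refine M.isCompact_polytope.inter_right ?_
    simp only [Set.ofPred_and, Set.ofPred_forall]
    exact (isClosed_le (continuous_apply a) continuous_const).inter
      (isClosed_iInter fun i => isClosed_iInter fun _ =>
        isClosed_le (continuous_apply i) continuous_const)
  obtain ⟨y, ⟨hy, hyK, hyx⟩, hmax⟩ := hF.exists_isMaxOn ⟨x, hx, hxK, fun i _ => le_rfl⟩
    (continuous_apply a).continuousOn
  refine ⟨y, hy, hyK.antisymm (not_lt.mp fun hlt => ?_), hyx⟩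
  have hsep : ∀ b, b ≠ a → ∃ S, M.Tight y S ∧ a ∈ S ∧ b ∉ S := by
    intro b hb
    by_contra! hcon
    obtain ⟨ε, hε, hεK, hmem⟩ := exists_transfer hy hcon (sub_pos.mpr hlt)
    have := hmax (a := y + Pi.single a ε - Pi.single b ε) ⟨hmem, ?_, fun i hi => ?_⟩
    · simp [hb.symm] at this
      linarith
    · simp [hb.symm]
      linarith
    · have h1 : 0 ≤ (Pi.single b ε : α → ℝ) i := 
        (Pi.single_nonneg.mpr hε.le : (0 : α → ℝ) ≤ Pi.single b ε) i
      have h2 := hyx i hi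
      simp only [Pi.sub_apply, Pi.add_apply, Pi.single_eq_of_ne hi]
      linarith
  have key : ∀ B : Finset α, a ∉ B → ∃ S, M.Tight y S ∧ a ∈ S ∧ Disjoint S B := by
    intro B
    induction B using Finset.induction_on with
    | empty => exact fun _ => ⟨Finset.univ, hy.1, Finset.mem_univ a, by simp⟩
    | insert b B _ ih =>
      intro hB
      rw [Finset.mem_insert, not_or] at hB
      obtain ⟨S, hS, haS, hd⟩ := ih hB.2
      obtain ⟨T, hT, haT, hbT⟩ := hsep b (Ne.symm hB.1)
      refine ⟨S ∩ T, (tight_union_inter hy hS hT).2, Finset.mem_inter.mpr ⟨haS, haT⟩, ?_⟩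
      rw [Finset.disjoint_insert_right]
      exact ⟨fun h => hbT (Finset.mem_inter.mp h).2,
        hd.mono_left Finset.inter_subset_left⟩
  obtain ⟨S, hS, haS, hd⟩ := key (Finset.univ.erase a) (by simp)
  have hSa : S = {a} := by
    ext i
    rw [Finset.mem_singleton]
    refine ⟨fun hi => ?_, fun hi => hi ▸ haS⟩
    by_contra hne
    exact Finset.disjoint_left.mp hd hi (by simp [hne])
  subst hSa
  simp only [Tight, Finset.sum_singleton] at hS
  linarith

/-- A point of the polytope can be moved down in direction `a`, raising the other coordinates. -/
lemma exists_lower (hx : x ∈ M.polytope) {K : ℝ} (hxK : K ≤ x a)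
    (hK : (M.rk Finset.univ : ℝ) - M.rk (Finset.univ.erase a) ≤ K) :
    ∃ y ∈ M.polytope, y a = K ∧ ∀ i, i ≠ a → x i ≤ y i := by
  let F : Set (α → ℝ) := M.polytope ∩ {y | K ≤ y a ∧ ∀ i, i ≠ a → x i ≤ y i}
  have hF : IsCompact F := by
    refine M.isCompact_polytope.inter_right ?_
    simp only [Set.ofPred_and, Set.ofPred_forall]
    exact (isClosed_le continuous_const (continuous_apply a)).inter
      (isClosed_iInter fun i => isClosed_iInter fun _ =>
        isClosed_le continuous_const (continuous_apply i))
  obtain ⟨y, ⟨hy, hyK, hyx⟩, hmin⟩ := hF.exists_isMinOn ⟨x, hx, hxK, fun i _ => le_rfl⟩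
    (continuous_apply a).continuousOn
  refine ⟨y, hy, hyK.antisymm' (not_lt.mp fun hlt => ?_), hyx⟩
  have hsep : ∀ b, b ≠ a → ∃ S, M.Tight y S ∧ b ∈ S ∧ a ∉ S := by
    intro b hb
    by_contra! hcon
    obtain ⟨ε, hε, hεK, hmem⟩ := exists_transfer hy hcon (sub_pos.mpr hlt)
    have := hmin (a := y + Pi.single b ε - Pi.single a ε) ⟨hmem, ?_, fun i hi => ?_⟩
    · simp [hb.symm] at this
      linarith
    · simp [hb.symm]
      linarith
    · have h1 : 0 ≤ (Pi.single b ε : α → ℝ) i := 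
        (Pi.single_nonneg.mpr hε.le : (0 : α → ℝ) ≤ Pi.single b ε) i
      have h2 := hyx i hi
      simp only [Pi.sub_apply, Pi.add_apply, Pi.single_eq_of_ne hi]
      linarith
  have key : ∀ B : Finset α, a ∉ B → ∃ S, M.Tight y S ∧ a ∉ S ∧ B ⊆ S := by
    intro B
    induction B using Finset.induction_on with
    | empty => exact fun _ => ⟨∅, by simp [Tight, M.rk_empty], by simp, by simp⟩
    | insert b B _ ih =>
      intro hB
      rw [Finset.mem_insert, not_or] at hB
      obtain ⟨S, hS, haS, hd⟩ := ih hB.2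
      obtain ⟨T, hT, hbT, haT⟩ := hsep b (Ne.symm hB.1)
      refine ⟨S ∪ T, (tight_union_inter hy hS hT).1, by simp [haS, haT], ?_⟩
      exact Finset.insert_subset (Finset.mem_union_right _ hbT)
        (hd.trans Finset.subset_union_left)
  obtain ⟨S, hS, haS, hd⟩ := key (Finset.univ.erase a) (by simp)
  have hSa : S = Finset.univ.erase a := by
    refine Finset.Subset.antisymm (fun i hi => ?_) hd
    rw [Finset.mem_erase]
    exact ⟨fun h => haS (h ▸ hi), Finset.mem_univ i⟩
  subst hSa
  have := Finset.add_sum_erase Finset.univ y (Finset.mem_univ a)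
  rw [Tight] at hS
  linarith [hy.1]

/-- Raising the `a`-coordinate of `x` towards that of `q` does not increase the total
positive part of `q - x`. -/
lemma exists_raise_sum_le (hx : x ∈ M.polytope) (q : α → ℝ) {K : ℝ} (hxK : x a ≤ K)
    (hK : K ≤ M.rk {a}) (hq : K ≤ q a) :
    ∃ y ∈ M.polytope, y a = K ∧ ∑ i, max (q i - y i) 0 ≤ ∑ i, max (q i - x i) 0 := by
  obtain ⟨y, hy, hya, hyx⟩ := exists_raise hx hxK hK
  refine ⟨y, hy, hya, ?_⟩
  have hle : ∀ i, max (q i - y i) 0 ≤ max (q i - x i) 0 + (x i - y i) := by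
    intro i
    by_cases hi : i = a
    · subst hi
      rw [max_eq_left (by linarith), max_eq_left (by linarith)]
      linarith
    · have := hyx i hi
      have h1 := le_max_left (q i - x i) 0
      have h2 := le_max_right (q i - x i) 0
      exact max_le (by linarith) (by linarith)
  refine (Finset.sum_le_sum fun i _ => hle i).trans ?_
  rw [Finset.sum_add_distrib, Finset.sum_sub_distrib, hx.1, hy.1]
  simp

/-- Lowering the `a`-coordinate of `x` towards that of `q` does not increase the total
positive part of `q - x`. -/
lemma exists_lower_sum_le (hx : x ∈ M.polytope) (q : α → ℝ) {K : ℝ} (hxK : K ≤ x a)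
    (hK : (M.rk Finset.univ : ℝ) - M.rk (Finset.univ.erase a) ≤ K) (hq : q a ≤ K) :
    ∃ y ∈ M.polytope, y a = K ∧ ∑ i, max (q i - y i) 0 ≤ ∑ i, max (q i - x i) 0 := by
  obtain ⟨y, hy, hya, hyx⟩ := exists_lower hx hxK hK
  refine ⟨y, hy, hya, Finset.sum_le_sum fun i _ => ?_⟩
  by_cases hi : i = a
  · subst hi
    rw [max_eq_right (by linarith), max_eq_right (by linarith)]
  · exact max_le_max (by linarith [hyx i hi]) le_rfl

lemma rk_sub_le_coord (hx : x ∈ M.polytope) :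
    (M.rk Finset.univ : ℝ) - M.rk (Finset.univ.erase a) ≤ x a := by
  have h := hx.2 (Finset.univ.erase a)
  have := Finset.add_sum_erase Finset.univ x (Finset.mem_univ a)
  linarith [hx.1]

/-- The lattice points counted by `Qcount M.polytope t u`. -/
def latticePoints (M : PolyMatroid α) (t u : ℕ) : Set (α → ℤ) :=
  {q | ∃ x ∈ M.polytope, ∑ i, (q i : ℝ) = M.rk Finset.univ + u - t ∧
    ∑ i, max ((q i : ℝ) - x i) 0 ≤ u}

/-- The lattice points counted by `QcountSlice a (M.slice a k) t u`. -/
def sliceLatticePoints (M : PolyMatroid α) (a : α) (k : ℤ) (t u : ℕ) : Set (α → ℤ) :=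
  {q | q a = k ∧ ∃ x ∈ M.polytope, x a = k ∧ ∑ i, (q i : ℝ) = M.rk Finset.univ + u - t ∧
    ∑ i, max ((q i : ℝ) - x i) 0 ≤ u}

lemma Qcount_eq [Nonempty α] (M : PolyMatroid α) (t u : ℕ) :
    Qcount M.polytope t u = (M.latticePoints t u).ncard := by
  rw [Qcount, latticeCount, latticePoints]
  congr 1
  ext q
  have h : stdSimplexSet α = convexHull ℝ {x | ∃ i : α, True ∧ x = Pi.single i (1 : ℝ)} := by
    simp [stdSimplexSet]
  rw [Set.mem_ofPred_eq, h, mem_add_smul_simplex_iff ⟨Classical.arbitrary α, trivial⟩]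
  refine exists_congr fun x => and_congr_right fun hx => ?_
  simp [hx.1]

lemma QcountSlice_eq [Nontrivial α] (M : PolyMatroid α) (a : α) (k : ℤ) (t u : ℕ) :
    QcountSlice a (M.slice a k) t u = (M.sliceLatticePoints a k t u).ncard := by
  rw [QcountSlice, latticeCount, sliceLatticePoints]
  congr 1
  ext q
  rw [Set.mem_ofPred_eq, stdSimplexAway, mem_add_smul_simplex_iff (exists_ne a)]
  constructor
  · rintro ⟨x, ⟨hx, hxa⟩, hq, hs, hp⟩
    have := hq a (by simp)
    exact ⟨by exact_mod_cast this.trans hxa, x, hx, hxa, by rw [hs, hx.1], hp⟩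
  · rintro ⟨hqa, x, hx, hxa, hs, hp⟩
    refine ⟨x, ⟨hx, hxa⟩, fun i hi => ?_, by rw [hs, hx.1], hp⟩
    obtain rfl := not_not.mp hi
    rw [hxa, hqa]

lemma sum_max_swap {ι : Type*} [Fintype ι] (q x : ι → ℝ) :
    ∑ i, max (x i - q i) 0 = ∑ i, max (q i - x i) 0 - ∑ i, q i + ∑ i, x i := by
  rw [← Finset.sum_sub_distrib, ← Finset.sum_add_distrib]
  refine Finset.sum_congr rfl fun i _ => ?_
  rcases le_total (q i) (x i) with h | h
  · rw [max_eq_right (a := q i - x i) (by linarith), max_eq_left (by linarith)]; ring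
  · rw [max_eq_left (a := q i - x i) (by linarith), max_eq_right (by linarith)]; ring

lemma coord_bounds {q : α → ℝ} {t u : ℝ} (hx : x ∈ M.polytope)
    (hs : ∑ i, q i = M.rk Finset.univ + u - t) (hp : ∑ i, max (q i - x i) 0 ≤ u) (i : α) :
    x i - t ≤ q i ∧ q i ≤ x i + u := by
  have h1 := Finset.single_le_sum (f := fun i => max (q i - x i) 0)
    (fun j _ => le_max_right _ _) (Finset.mem_univ i)
  have h2 := Finset.single_le_sum (f := fun i => max (x i - q i) 0)
    (fun j _ => le_max_right _ _) (Finset.mem_univ i)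
  simp only [sum_max_swap q x, hx.1, hs] at h1 h2
  have h3 := le_max_left (q i - x i) 0
  have h4 := le_max_left (x i - q i) 0
  constructor <;> linarith

lemma finite_latticePoints (M : PolyMatroid α) (t u : ℕ) : (M.latticePoints t u).Finite := by
  refine (Set.finite_Icc (fun _ => -(t : ℤ)) fun i => (M.rk {i} : ℤ) + u).subset ?_
  rintro q ⟨x, hx, hs, hp⟩
  refine ⟨fun i => ?_, fun i => ?_⟩
  · have h1 := (coord_bounds (q := fun i => (q i : ℝ)) hx hs hp i).1
    have h2 := coord_nonneg hx i
    have : (-(t : ℝ)) ≤ q i := by linarith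
    exact_mod_cast this
  · have h1 := (coord_bounds (q := fun i => (q i : ℝ)) hx hs hp i).2
    have h2 := coord_le hx i
    have : (q i : ℝ) ≤ M.rk {i} + u := by linarith
    exact_mod_cast this

section Fibers

variable {kl kh : ℤ} {t u : ℕ}

lemma sum_add_single (q : α → ℤ) (j : ℤ) :
    ∑ i, (((q + Pi.single a j : α → ℤ) i : ℤ) : ℝ) = ∑ i, (q i : ℝ) + j := by
  simp only [Pi.add_apply, Int.cast_add, Finset.sum_add_distrib, add_right_inj]
  rw [← Int.cast_sum]
  simp

lemma sum_max_add_single (q : α → ℤ) (j : ℤ) :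
    ∑ i, max (((q + Pi.single a j : α → ℤ) i : ℝ) - x i) 0 =
      ∑ i, max ((q i : ℝ) - x i) 0 +
        (max ((q a : ℝ) + j - x a) 0 - max ((q a : ℝ) - x a) 0) := by
  rw [← Finset.add_sum_erase _ _ (Finset.mem_univ a),
    ← Finset.add_sum_erase Finset.univ (fun i => max ((q i : ℝ) - x i) 0) (Finset.mem_univ a)]
  have : ∑ i ∈ Finset.univ.erase a, max (((q + Pi.single a j : α → ℤ) i : ℝ) - x i) 0 =
      ∑ i ∈ Finset.univ.erase a, max ((q i : ℝ) - x i) 0 :=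
    Finset.sum_congr rfl fun i hi => by simp [Finset.ne_of_mem_erase hi]
  rw [this]
  simp only [Pi.add_apply, Pi.single_eq_same, Int.cast_add]
  ring

lemma mem_sliceLatticePoints_iff (hkl : IsLeast {r : ℝ | ∃ x ∈ M.polytope, x a = r} (kl : ℝ))
    (hkh : IsGreatest {r : ℝ | ∃ x ∈ M.polytope, x a = r} (kh : ℝ)) {k : ℤ}
    (hk : k ∈ Finset.Icc kl kh) (q : α → ℤ) :
    q ∈ M.sliceLatticePoints a k t u ↔ q ∈ M.latticePoints t u ∧ q a = k := by
  rw [Finset.mem_Icc] at hk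
  have hkl' : (kl : ℝ) ≤ k := by exact_mod_cast hk.1
  have hkh' : (k : ℝ) ≤ kh := by exact_mod_cast hk.2
  obtain ⟨xl, hxl, hxla⟩ := hkl.1
  obtain ⟨xh, hxh, hxha⟩ := hkh.1
  constructor
  · rintro ⟨hqa, x, hx, -, hs, hp⟩
    exact ⟨⟨x, hx, hs, hp⟩, hqa⟩
  · rintro ⟨⟨x, hx, hs, hp⟩, hqa⟩
    have hqa' : (q a : ℝ) = k := by exact_mod_cast hqa
    refine ⟨hqa, ?_⟩
    rcases le_total (x a) k with h | h
    · obtain ⟨y, hy, hya, hle⟩ := exists_raise_sum_le hx (fun i => (q i : ℝ)) h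
        (by linarith [coord_le hxh a]) hqa'.ge
      exact ⟨y, hy, hya, hs, hle.trans hp⟩
    · obtain ⟨y, hy, hya, hle⟩ := exists_lower_sum_le hx (fun i => (q i : ℝ)) h
        (by linarith [rk_sub_le_coord (a := a) hxl]) hqa'.le
      exact ⟨y, hy, hya, hs, hle.trans hp⟩

lemma mem_sliceLatticePoints_top_iff
    (hkh : IsGreatest {r : ℝ | ∃ x ∈ M.polytope, x a = r} (kh : ℝ)) {s : ℕ} (hs : s ≤ u)
    (q : α → ℤ) :
    q ∈ M.sliceLatticePoints a kh t s ↔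
      q + Pi.single a ((u : ℤ) - s) ∈ M.latticePoints t u ∧
        (q + Pi.single a ((u : ℤ) - s) : α → ℤ) a = kh + u - s := by
  have hsu : (s : ℝ) ≤ u := by exact_mod_cast hs
  have hqa : (q + Pi.single a ((u : ℤ) - s) : α → ℤ) a = kh + u - s ↔ q a = kh := by
    simp only [Pi.add_apply, Pi.single_eq_same]
    omega
  obtain ⟨xh, hxh, hxha⟩ := hkh.1
  have hmax : ∀ x : α → ℝ, x a = kh → q a = kh →
      ∑ i, max (((q + Pi.single a ((u : ℤ) - s) : α → ℤ) i : ℝ) - x i) 0 =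
        ∑ i, max ((q i : ℝ) - x i) 0 + (u - s) := by
    intro x hxa hq
    rw [sum_max_add_single, hxa, hq]
    push_cast
    rw [max_eq_left (by linarith), max_eq_right (by linarith)]
    ring
  rw [hqa]
  constructor
  · rintro ⟨hq, x, hx, hxa, hsum, hp⟩
    refine ⟨⟨x, hx, ?_, ?_⟩, hq⟩
    · rw [sum_add_single, hsum]; push_cast; ring
    · rw [hmax x hxa hq]; linarith
  · rintro ⟨⟨x, hx, hsum, hp⟩, hq⟩
    obtain ⟨y, hy, hya, hle⟩ := exists_raise_sum_le (a := a) hx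
      (fun i => ((q + Pi.single a ((u : ℤ) - s) : α → ℤ) i : ℝ)) (hkh.2 ⟨x, hx, rfl⟩)
      (by linarith [coord_le hxh a])
      (by simp only [Pi.add_apply, Pi.single_eq_same, hq]; push_cast; linarith)
    refine ⟨hq, y, hy, hya, ?_, ?_⟩
    · rw [sum_add_single] at hsum; push_cast at hsum; linarith
    · rw [hmax y hya hq] at hle; linarith

lemma mem_sliceLatticePoints_bot_iff
    (hkl : IsLeast {r : ℝ | ∃ x ∈ M.polytope, x a = r} (kl : ℝ)) {s : ℕ} (hs : s ≤ t)
    (q : α → ℤ) :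
    q ∈ M.sliceLatticePoints a kl s u ↔
      q + Pi.single a ((s : ℤ) - t) ∈ M.latticePoints t u ∧
        (q + Pi.single a ((s : ℤ) - t) : α → ℤ) a = kl + s - t := by
  have hst : (s : ℝ) ≤ t := by exact_mod_cast hs
  have hqa : (q + Pi.single a ((s : ℤ) - t) : α → ℤ) a = kl + s - t ↔ q a = kl := by
    simp only [Pi.add_apply, Pi.single_eq_same]
    omega
  obtain ⟨xl, hxl, hxla⟩ := hkl.1
  have hmax : ∀ x : α → ℝ, x a = kl → q a = kl →
      ∑ i, max (((q + Pi.single a ((s : ℤ) - t) : α → ℤ) i : ℝ) - x i) 0 =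
        ∑ i, max ((q i : ℝ) - x i) 0 := by
    intro x hxa hq
    rw [sum_max_add_single, hxa, hq]
    push_cast
    rw [max_eq_right (by linarith), max_eq_right (by linarith)]
    ring
  rw [hqa]
  constructor
  · rintro ⟨hq, x, hx, hxa, hsum, hp⟩
    refine ⟨⟨x, hx, ?_, ?_⟩, hq⟩
    · rw [sum_add_single, hsum]; push_cast; ring
    · rwa [hmax x hxa hq]
  · rintro ⟨⟨x, hx, hsum, hp⟩, hq⟩
    obtain ⟨y, hy, hya, hle⟩ := exists_lower_sum_le (a := a) hx
      (fun i => ((q + Pi.single a ((s : ℤ) - t) : α → ℤ) i : ℝ)) (hkl.2 ⟨x, hx, rfl⟩)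
      (by linarith [rk_sub_le_coord (a := a) hxl])
      (by simp only [Pi.add_apply, Pi.single_eq_same, hq]; push_cast; linarith)
    refine ⟨hq, y, hy, hya, ?_, ?_⟩
    · rw [sum_add_single] at hsum; push_cast at hsum; linarith
    · rw [hmax y hya hq] at hle; linarith

lemma coord_mem_Icc_of_mem_latticePoints
    (hkl : IsLeast {r : ℝ | ∃ x ∈ M.polytope, x a = r} (kl : ℝ))
    (hkh : IsGreatest {r : ℝ | ∃ x ∈ M.polytope, x a = r} (kh : ℝ)) {q : α → ℤ}
    (hq : q ∈ M.latticePoints t u) : kl - t ≤ q a ∧ q a ≤ kh + u := by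
  obtain ⟨x, hx, hs, hp⟩ := hq
  have h := coord_bounds (q := fun i => (q i : ℝ)) hx hs hp a
  have hl : (kl : ℝ) ≤ x a := hkl.2 ⟨x, hx, rfl⟩
  have hh : x a ≤ (kh : ℝ) := hkh.2 ⟨x, hx, rfl⟩
  have h1 : (kl : ℝ) - t ≤ q a := by linarith
  have h2 : (q a : ℝ) ≤ kh + u := by linarith
  exact ⟨by exact_mod_cast h1, by exact_mod_cast h2⟩

lemma ncard_eq_of_translate {G : Type*} [AddGroup G] {S A : Set G} (v : G)
    (h : ∀ q, q ∈ S ↔ q + v ∈ A) : S.ncard = A.ncard := by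
  have : A = (fun q => q + v) '' S := by
    ext q
    constructor
    · exact fun hq => ⟨q - v, (h _).mpr (by simpa using hq), by simp⟩
    · rintro ⟨p, hp, rfl⟩
      exact (h p).mp hp
  rw [this, Set.ncard_image_of_injective _ (add_left_injective v)]

/-- Slicing the lattice points by the value of the coordinate `a`. -/
lemma ncard_latticePoints (hkl : IsLeast {r : ℝ | ∃ x ∈ M.polytope, x a = r} (kl : ℝ))
    (hkh : IsGreatest {r : ℝ | ∃ x ∈ M.polytope, x a = r} (kh : ℝ)) :
    (M.latticePoints t u).ncard =
      ∑ s ∈ Finset.range t, (M.sliceLatticePoints a kl s u).ncard +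
        ∑ s ∈ Finset.range u, (M.sliceLatticePoints a kh t s).ncard +
        ∑ k ∈ Finset.Icc kl kh, (M.sliceLatticePoints a k t u).ncard := by
  classical
  have hlh : kl ≤ kh := by exact_mod_cast hkl.2 hkh.1
  set A := (M.finite_latticePoints t u).toFinset with hA
  have hfib : ∀ m : ℤ, {q | q ∈ M.latticePoints t u ∧ q a = m}.ncard =
      (A.filter fun q => q a = m).card := by
    intro m
    rw [← Set.ncard_coe_finset]
    congr 1
    ext q
    simp [hA]
  let B : Finset ℤ := (Finset.range t).image fun s : ℕ => kl + s - t
  let T : Finset ℤ := (Finset.range u).image fun s : ℕ => kh + u - s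
  have hBT : Disjoint B T := by
    rw [Finset.disjoint_left]
    simp only [B, T, Finset.mem_image, Finset.mem_range]
    rintro _ ⟨s, hs, rfl⟩ ⟨s', hs', h⟩
    omega
  have hBTI : Disjoint (B ∪ T) (Finset.Icc kl kh) := by
    rw [Finset.disjoint_left]
    simp only [B, T, Finset.mem_union, Finset.mem_image, Finset.mem_range, Finset.mem_Icc]
    rintro _ (⟨s, hs, rfl⟩ | ⟨s, hs, rfl⟩) ⟨h1, h2⟩ <;> omega
  have hmaps : Set.MapsTo (fun q : α → ℤ => q a) A
      (B ∪ T ∪ Finset.Icc kl kh : Finset ℤ) := by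
    intro q hq
    obtain ⟨h1, h2⟩ :=
      coord_mem_Icc_of_mem_latticePoints hkl hkh ((Set.Finite.mem_toFinset _).mp hq)
    simp only [B, T, Finset.mem_coe, Finset.mem_union, Finset.mem_image, Finset.mem_range,
      Finset.mem_Icc]
    by_cases hl : q a < kl
    · exact Or.inl (Or.inl ⟨(q a - kl + t).toNat, by omega, by omega⟩)
    by_cases hh : kh < q a
    · exact Or.inl (Or.inr ⟨(kh + u - q a).toNat, by omega, by omega⟩)
    · exact Or.inr ⟨by omega, by omega⟩
  rw [Set.ncard_eq_toFinset_card _ (M.finite_latticePoints t u), ← hA,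
    Finset.card_eq_sum_card_fiberwise (f := fun q => q a) hmaps, Finset.sum_union hBTI,
    Finset.sum_union hBT, Finset.sum_image fun i _ j _ h => by simpa using h,
    Finset.sum_image fun i _ j _ h => by simpa using h]
  congr 1
  · congr 1
    · refine Finset.sum_congr rfl fun s hs => ?_
      rw [← hfib]
      exact (ncard_eq_of_translate _ fun q =>
        mem_sliceLatticePoints_bot_iff hkl (Finset.mem_range.mp hs).le q).symm
    · refine Finset.sum_congr rfl fun s hs => ?_
      rw [← hfib]
      exact (ncard_eq_of_translate _ fun q =>
        mem_sliceLatticePoints_top_iff hkh (Finset.mem_range.mp hs).le q).symm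
  · refine Finset.sum_congr rfl fun k hk => ?_
    rw [← hfib]
    congr 1
    ext q
    exact (mem_sliceLatticePoints_iff hkl hkh hk q).symm

end Fibers

end PolyMatroid

/-- The slice recurrence for polymatroids:
`Q'_M = (x−1) Q'_{N_k̲} + (y−1) Q'_{N_k̄} + Σ_{k=k̲}^{k̄} Q'_{N_k}`. -/
theorem stmt_13 {α : Type*} [Fintype α] [DecidableEq α] (hcard : 2 ≤ Fintype.card α)
    (M : PolyMatroid α) (a : α) (kl kh : ℤ)
    (hkl : IsLeast {r : ℝ | ∃ x ∈ M.polytope, x a = r} (kl : ℝ))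
    (hkh : IsGreatest {r : ℝ | ∃ x ∈ M.polytope, x a = r} (kh : ℝ))
    (c : ℕ × ℕ → ℤ) (hc : IsQdatum M.polytope c)
    (cN : ℤ → ℕ × ℕ → ℤ)
    (hcN : ∀ k ∈ Finset.Icc kl kh, IsQdatumFun (QcountSlice a (M.slice a k)) (cN k)) :
    QprimePoly c =
      (MvPolynomial.X 0 - 1) * QprimePoly (cN kl) +
        (MvPolynomial.X 1 - 1) * QprimePoly (cN kh) +
        ∑ k ∈ Finset.Icc kl kh, QprimePoly (cN k) := by
  have : Nontrivial α := Fintype.one_lt_card_iff_nontrivial.mp hcard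
  have hlh : kl ≤ kh := by exact_mod_cast hkl.2 hkh.1
  obtain ⟨d, rfl⟩ := hc.exists_finsupp
  choose! dN hdN using fun k hk => (hcN k hk).exists_finsupp
  have hdat : ∀ k ∈ Finset.Icc kl kh, ∀ t u,
      binomialEval t u (dN k) = (M.sliceLatticePoints a k t u).ncard := by
    intro k hk t u
    have h := hcN k hk
    rw [hdN k hk] at h
    rw [h.binomialEval_eq, M.QcountSlice_eq]
  have hl : kl ∈ Finset.Icc kl kh := Finset.left_mem_Icc.mpr hlh
  have hh : kh ∈ Finset.Icc kl kh := Finset.right_mem_Icc.mpr hlh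
  have key : d = (dN kl).mapDomain (fun p => (p.1 + 1, p.2)) +
      (dN kh).mapDomain (fun p => (p.1, p.2 + 1)) + ∑ k ∈ Finset.Icc kl kh, dN k := by
    refine eq_of_binomialEval_eq fun t u => ?_
    rw [IsQdatumFun.binomialEval_eq hc, M.Qcount_eq, PolyMatroid.ncard_latticePoints hkl hkh,
      map_add, map_add, map_sum, binomialEval_mapDomain_fst, binomialEval_mapDomain_snd]
    push_cast
    congr 1
    · congr 1
      · exact Finset.sum_congr rfl fun s _ => (hdat kl hl s u).symm
      · exact Finset.sum_congr rfl fun s _ => (hdat kh hh t s).symm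
    · exact Finset.sum_congr rfl fun k hk => (hdat k hk t u).symm
  rw [hdN kl hl, hdN kh hh, Finset.sum_congr rfl fun k hk => by rw [hdN k hk, QprimePoly_coe]]
  simp only [QprimePoly_coe]
  rw [key, map_add, map_add, map_sum, shiftedPoly_mapDomain_fst, shiftedPoly_mapDomain_snd]

end
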